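/- Let τ > 0, θ ≥ 0, q ≥ 0 and ξ_U, ξ_D ∈ ℝ with ξ_D ≤ ξ_U < 0, and let S = {(u, d) ∈ ℝ² : u ≥ 0, d ≥ 0, u + d ≤ τ, u ≤ θ, d ≤ q}. If θ ≥ τ − min{τ, q}, then the point (τ − min{τ, q}, min{τ, q}) minimizes L(u, d) = ξ_U·u + ξ_D·d over S. -/

import Mathlib

theorem stmt_14 (τ θ q ξU ξD : ℝ) (hτ : 0 < τ) (hθ : 0 ≤ θ) (hq : 0 ≤ q)
    (h1 : ξD ≤ ξU) (h2 : ξU < 0) (hθ' : τ - min τ q ≤ θ) :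
    let S : Set (ℝ × ℝ) := {p | 0 ≤ p.1 ∧ 0 ≤ p.2 ∧ p.1 + p.2 ≤ τ ∧ p.1 ≤ θ ∧ p.2 ≤ q}
    let L : ℝ × ℝ → ℝ := fun p => ξU * p.1 + ξD * p.2
    ((τ - min τ q, min τ q) : ℝ × ℝ) ∈ S ∧ ∀ p ∈ S, L (τ - min τ q, min τ q) ≤ L p := by
  intro S L
  have hm1 : min τ q ≤ τ := min_le_left _ _
  have hm2 : min τ q ≤ q := min_le_right _ _
  have hm0 : 0 ≤ min τ q := le_min hτ.le hq
  refine ⟨⟨by simpa using hm1, hm0, by simp, hθ', hm2⟩, ?_⟩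
  rintro ⟨u, d⟩ ⟨hu, hd, hud, huθ, hdq⟩
  simp only at hu hd hud huθ hdq
  have hdm : d ≤ min τ q := le_min (by linarith) hdq
  change ξU * (τ - min τ q) + ξD * min τ q ≤ ξU * u + ξD * d
  have a := mul_nonneg (sub_nonneg.2 h1) (sub_nonneg.2 hdm)
  have b := mul_nonneg (neg_nonneg.2 h2.le) (sub_nonneg.2 hud)
  linarith
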